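/- arXiv:1309.3702 — 6 statements merged into one kernel-verified Lean document; each statement's English description precedes it below -/
import Mathlib

section
/- Let (X,d) be a metric space, φ : [0,∞) → [0,∞) be increasing, and T : X → X be anticipative (d;φ)-contractive. Fix x₀ ∈ X and set xₙ = Tⁿx₀ for n ≥ 0. Then for all integers 1 ≤ i ≤ j one has d(xᵢ, xⱼ) ≤ φ(diam{xₕ : i−1 ≤ h ≤ j}), where diam{xₕ : i−1 ≤ h ≤ j} denotes the maximum of d(xₚ,x_q) over i−1 ≤ p,q ≤ j. -/
open Filter Topology

/-- `B(x,y) = diam {x, Tx, T²x, y, Ty}`. -/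
noncomputable def Bdiam {X : Type*} [MetricSpace X] (T : X → X) (x y : X) : ℝ :=
  Metric.diam ({x, T x, T (T x), y, T y} : Set X)

theorem orbit_segment_estimate {X : Type*} [MetricSpace X]
    (T : X → X) (φ : ℝ → ℝ)
    (hφ_nonneg : ∀ t, 0 ≤ t → 0 ≤ φ t)
    (hφ_mono : ∀ s t, 0 ≤ s → s ≤ t → φ s ≤ φ t)
    (hcontr : ∀ x y : X, dist (T x) (T y) ≤ φ (Bdiam T x y))
    (x₀ : X) (x : ℕ → X) (hx : ∀ n, x n = T^[n] x₀)
    (i j : ℕ) (hi : 1 ≤ i) (hij : i ≤ j) :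
    dist (x i) (x j) ≤ φ (Metric.diam (x '' Set.Icc (i - 1) j)) := by
  rcases hij.eq_or_lt with rfl | hlt
  · rw [dist_self]
    exact hφ_nonneg _ Metric.diam_nonneg
  obtain ⟨k, rfl⟩ : ∃ k, i = k + 1 := ⟨i - 1, by omega⟩
  obtain ⟨m, rfl⟩ : ∃ m, j = m + 1 := ⟨j - 1, by omega⟩
  have hT : ∀ n, T (x n) = x (n + 1) := fun n => by
    rw [hx, hx, Function.iterate_succ_apply']
  have hB := hcontr (x k) (x m)
  simp only [Bdiam, hT] at hB
  refine hB.trans (hφ_mono _ _ Metric.diam_nonneg (Metric.diam_mono ?_ ?_))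
  · simp only [Set.insert_subset_iff, Set.singleton_subset_iff]
    refine ⟨?_, ?_, ?_, ?_, ?_⟩ <;>
      exact Set.mem_image_of_mem x (Set.mem_Icc.2 ⟨by omega, by omega⟩)
  · exact ((Set.finite_Icc _ _).image x).isBounded
end

section
/- Let (X,d) be a metric space, φ : [0,∞) → [0,∞) be increasing and regressive, and T : X → X be anticipative (d;φ)-contractive. Fix x₀ ∈ X with x₀ ≠ Tx₀, set xₙ = Tⁿx₀ for n ≥ 0, put α = d(x₀,x₁) > 0, and let β > α be such that for every t ≥ 0, t ≤ α + φ(t) implies t ≤ β. Then for every n ≥ 1, diam{x₀, x₁, …, xₙ} ≤ β (where diam denotes the maximum of the pairwise distances), and consequently d(xₚ,x_q) ≤ β for all p,q ≥ 0. -/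
open Filter Topology

/-- Under an anticipative contraction, two points of an orbit segment other than its starting
point are at distance at most `φ` of the diameter of the segment. -/
lemma dist_orbit_le_of_contractive {X : Type*} [MetricSpace X] {T : X → X} {φ : ℝ → ℝ}
    (hφ_mono : ∀ s t, 0 ≤ s → s ≤ t → φ s ≤ φ t)
    (hcontr : ∀ x y : X, dist (T x) (T y) ≤ φ (Bdiam T x y))
    {x : ℕ → X} (hx : ∀ n, x (n + 1) = T (x n)) {n i j : ℕ} (hij : i < j) (hj : j + 1 ≤ n) :
    dist (x (i + 1)) (x (j + 1)) ≤ φ (Metric.diam (x '' Set.Icc 0 n)) := by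
  rw [hx i, hx j]
  refine (hcontr _ _).trans (hφ_mono _ _ Metric.diam_nonneg (Metric.diam_mono ?_ ?_))
  · rw [← hx i, ← hx (i + 1), ← hx j]
    have mem : ∀ k, k ≤ n → x k ∈ x '' Set.Icc 0 n := fun k hk => ⟨k, ⟨k.zero_le, hk⟩, rfl⟩
    rintro _ (rfl | rfl | rfl | rfl | rfl) <;> exact mem _ (by omega)
  · exact ((Set.finite_Icc 0 n).image x).isBounded

theorem orbit_diameter_bound {X : Type*} [MetricSpace X]
    (T : X → X) (φ : ℝ → ℝ)
    (hφ_nonneg : ∀ t, 0 ≤ t → 0 ≤ φ t)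
    (hφ_mono : ∀ s t, 0 ≤ s → s ≤ t → φ s ≤ φ t)
    (hφ_reg0 : φ 0 = 0) (hφ_reg : ∀ t, 0 < t → φ t < t)
    (hcontr : ∀ x y : X, dist (T x) (T y) ≤ φ (Bdiam T x y))
    (x₀ : X) (hx₀ : x₀ ≠ T x₀) (x : ℕ → X) (hx : ∀ n, x n = T^[n] x₀)
    (α β : ℝ) (hα : α = dist x₀ (T x₀)) (hαβ : α < β)
    (hβ : ∀ t : ℝ, 0 ≤ t → t ≤ α + φ t → t ≤ β) :
    (∀ n : ℕ, 1 ≤ n → Metric.diam (x '' Set.Icc 0 n) ≤ β) ∧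
      ∀ p q : ℕ, dist (x p) (x q) ≤ β := by
  have hx_succ : ∀ n, x (n + 1) = T (x n) := fun n => by
    rw [hx, hx, Function.iterate_succ_apply']
  have hα_dist : dist (x 0) (x 1) = α := by rw [hα, hx, hx]; rfl
  have hα_nonneg : 0 ≤ α := hα ▸ dist_nonneg
  have diam_le : ∀ n : ℕ, Metric.diam (x '' Set.Icc 0 n) ≤ β := fun n => by
    have hφ_diam := hφ_nonneg _ (Metric.diam_nonneg (s := x '' Set.Icc 0 n))
    have dist_le_of_lt : ∀ i j, i < j → j ≤ n →
        dist (x i) (x j) ≤ α + φ (Metric.diam (x '' Set.Icc 0 n)) := by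
      rintro (_ | i) (_ | _ | j) hij hj
      · omega
      · rw [zero_add, hα_dist]
        linarith
      · have htri := dist_triangle (x 0) (x 1) (x (j + 1 + 1))
        have hle := dist_orbit_le_of_contractive hφ_mono hcontr hx_succ j.succ_pos hj
        rw [zero_add] at hle
        linarith
      · omega
      · omega
      · have hle := dist_orbit_le_of_contractive hφ_mono hcontr hx_succ
          (Nat.lt_of_succ_lt_succ hij) hj
        linarith
    refine hβ _ Metric.diam_nonneg (Metric.diam_le_of_forall_dist_le (by linarith) ?_)
    rintro _ ⟨i, hi, rfl⟩ _ ⟨j, hj, rfl⟩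
    rcases lt_trichotomy i j with h | rfl | h
    · exact dist_le_of_lt i j h hj.2
    · rw [dist_self]
      linarith
    · rw [dist_comm]
      exact dist_le_of_lt j i h hi.2
  refine ⟨fun n _ => diam_le n, fun p q => ?_⟩
  exact (Metric.dist_le_diam_of_mem ((Set.finite_Icc 0 (max p q)).image x).isBounded
    ⟨p, ⟨p.zero_le, le_max_left p q⟩, rfl⟩ ⟨q, ⟨q.zero_le, le_max_right p q⟩, rfl⟩).trans
    (diam_le (max p q))
end

section
/- Let (X,d) be a metric space, φ : [0,∞) → [0,∞) be increasing, regressive, and Matkowski admissible, and T : X → X be anticipative (d;φ)-contractive. Fix x₀ ∈ X with x₀ ≠ Tx₀, set xₙ = Tⁿx₀ for n ≥ 0, and suppose β > 0 satisfies d(xₚ,x_q) ≤ β for all p,q ≥ 0. Then for every n ≥ 0, sup{d(xᵢ,xⱼ) : i,j ≥ n} ≤ φⁿ(β); in particular, (xₙ)ₙ≥₀ is a d-Cauchy sequence. -/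
open Filter Topology

/-- A bound on the pairwise distances of the tail of an orbit bounds `Bdiam` along that tail. -/
theorem Bdiam_le_of_tail_bound {X : Type*} [MetricSpace X] {T : X → X} {x : ℕ → X}
    (hstep : ∀ n, T (x n) = x (n + 1)) {n : ℕ} {c : ℝ} (hc : 0 ≤ c)
    (hbound : ∀ i j, n ≤ i → n ≤ j → dist (x i) (x j) ≤ c)
    {i j : ℕ} (hi : n ≤ i) (hj : n ≤ j) : Bdiam T (x i) (x j) ≤ c := by
  have hsub : ({x i, T (x i), T (T (x i)), x j, T (x j)} : Set X) ⊆ x '' Set.Ici n := by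
    simp only [hstep, Set.insert_subset_iff, Set.singleton_subset_iff]
    refine ⟨?_, ?_, ?_, ?_, ?_⟩ <;> exact Set.mem_image_of_mem x (Set.mem_Ici.2 (by omega))
  refine Metric.diam_le_of_forall_dist_le hc fun a ha b hb => ?_
  obtain ⟨p, hp, rfl⟩ := hsub ha
  obtain ⟨q, hq, rfl⟩ := hsub hb
  exact hbound p q hp hq

theorem orbit_tail_diameter_and_cauchy {X : Type*} [MetricSpace X]
    (T : X → X) (φ : ℝ → ℝ)
    (hφ_nonneg : ∀ t, 0 ≤ t → 0 ≤ φ t)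
    (hφ_mono : ∀ s t, 0 ≤ s → s ≤ t → φ s ≤ φ t)
    (hφ_reg0 : φ 0 = 0) (hφ_reg : ∀ t, 0 < t → φ t < t)
    (hφ_matk : ∀ t, 0 < t → Tendsto (fun n => φ^[n] t) atTop (𝓝 0))
    (hcontr : ∀ x y : X, dist (T x) (T y) ≤ φ (Bdiam T x y))
    (x₀ : X) (hx₀ : x₀ ≠ T x₀) (x : ℕ → X) (hx : ∀ n, x n = T^[n] x₀)
    (β : ℝ) (hβpos : 0 < β) (hβ : ∀ p q : ℕ, dist (x p) (x q) ≤ β) :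
    (∀ n i j : ℕ, n ≤ i → n ≤ j → dist (x i) (x j) ≤ φ^[n] β) ∧ CauchySeq x := by
  have hstep : ∀ n, T (x n) = x (n + 1) := fun n => by
    rw [hx, hx, Function.iterate_succ_apply']
  have htail : ∀ n i j : ℕ, n ≤ i → n ≤ j → dist (x i) (x j) ≤ φ^[n] β := by
    intro n
    induction n with
    | zero => exact fun i j _ _ => hβ i j
    | succ n ih =>
      intro i j hi hj
      obtain ⟨i, rfl⟩ := Nat.exists_eq_succ_of_ne_zero (by omega : i ≠ 0)
      obtain ⟨j, rfl⟩ := Nat.exists_eq_succ_of_ne_zero (by omega : j ≠ 0)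
      have hc : 0 ≤ φ^[n] β := dist_nonneg.trans (ih n n le_rfl le_rfl)
      rw [Nat.succ_eq_add_one, Nat.succ_eq_add_one, ← hstep, ← hstep,
        Function.iterate_succ_apply']
      exact (hcontr _ _).trans (hφ_mono _ _ Metric.diam_nonneg
        (Bdiam_le_of_tail_bound hstep hc ih (by omega) (by omega)))
  exact ⟨htail, cauchySeq_of_le_tendsto_0 (fun n => φ^[n] β)
    (fun i j n hi hj => htail n i j hi hj) (hφ_matk β hβpos)⟩
end

section
/- Let G be a Mustafa–Sims metric on a nonempty set X. Then for all x,y,z,u ∈ X: G(x,y,z) ≤ (2/3)·[G(x,u,y) + G(y,u,z) + G(z,u,x)]. In particular, G is tetrahedral: G(x,y,z) ≤ G(x,y,u) + G(x,u,z) + G(u,y,z) for all x,y,z,u ∈ X. -/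
open Filter Topology

/-- A Mustafa–Sims metric on `X`: nonnegative, totally symmetric (the two
transpositions below generate all permutations of the three arguments),
reflexive, plane sufficient, with the MS-property and the MS-triangle
inequality. -/
structure IsMSMetric {X : Type*} (G : X → X → X → ℝ) : Prop where
  nonneg : ∀ x y z, 0 ≤ G x y z
  swap_left : ∀ x y z, G x y z = G y x z
  swap_right : ∀ x y z, G x y z = G x z y
  refl : ∀ x, G x x x = 0
  eq_of_zero : ∀ x y, G x x y = 0 → x = y
  ms : ∀ x y z, y ≠ z → G x x y ≤ G x y z
  tri : ∀ x y z u, G x y z ≤ G x u u + G u y z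

namespace IsMSMetric

variable {X : Type*} {G : X → X → X → ℝ}

theorem le_add_of_ne (hG : IsMSMetric G) {x y : X} (z u : X) (hxy : x ≠ y) :
    G x y z ≤ G x u y + G y u z := by
  have h₁ := hG.tri x y z u
  have h₂ := hG.ms u x y hxy
  rw [hG.swap_left x u u, hG.swap_right u x u] at h₁
  rw [hG.swap_left x u y, hG.swap_left y u z]
  linarith

theorem two_thirds_of_pair (hG : IsMSMetric G) (x z u : X) :
    G x x z ≤ (2 / 3) * (G x x u + 2 * G x u z) := by
  rcases eq_or_ne x z with rfl | hxz
  · linarith [hG.refl x, hG.nonneg x x u, hG.nonneg x u x]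
  · have h₁ := hG.le_add_of_ne x u hxz
    have h₂ := hG.le_add_of_ne x u hxz.symm
    rw [hG.swap_right x z x] at h₁
    rw [hG.swap_left z x x, hG.swap_right x z x, hG.swap_right x u x] at h₂
    have h₃ : G z u x = G x u z := by
      rw [hG.swap_right, hG.swap_left, hG.swap_right]
    linarith

theorem two_thirds (hG : IsMSMetric G) (x y z u : X) :
    G x y z ≤ (2 / 3) * (G x u y + G y u z + G z u x) := by
  have rev (a b c : X) : G a b c = G c b a := by
    rw [hG.swap_right, hG.swap_left, hG.swap_right]
  rcases eq_or_ne x y with rfl | hxy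
  · linarith [hG.two_thirds_of_pair x z u, hG.swap_right x x u, rev x u z]
  rcases eq_or_ne y z with rfl | hyz
  · linarith [hG.two_thirds_of_pair y x u, hG.swap_right y y u, rev x u y, rev x y y]
  rcases eq_or_ne z x with rfl | hzx
  · linarith [hG.two_thirds_of_pair z y u, hG.swap_right z z u, rev z u y, hG.swap_right z z y]
  linarith [hG.le_add_of_ne z u hxy, hG.le_add_of_ne x u hyz, hG.le_add_of_ne y u hzx,
    rev y z x, hG.swap_right x z y, hG.swap_left z x y]

end IsMSMetric

theorem ms_two_thirds_and_tetrahedral {X : Type*} [Nonempty X] (G : X → X → X → ℝ)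
    (hG : IsMSMetric G) :
    (∀ x y z u : X, G x y z ≤ (2 / 3) * (G x u y + G y u z + G z u x)) ∧
      (∀ x y z u : X, G x y z ≤ G x y u + G x u z + G u y z) := by
  refine ⟨hG.two_thirds, fun x y z u => ?_⟩
  have h := hG.two_thirds x y z u
  rw [hG.swap_right x u y, hG.swap_left y u z, hG.swap_left z u x, hG.swap_right u z x,
    hG.swap_left u x z] at h
  linarith [hG.nonneg x y u, hG.nonneg x u z, hG.nonneg u y z]
end

section
/- Let G be a Mustafa–Sims metric on a nonempty set X which is perfect: for each x ∈ X there exists a sequence (xₙ) with xₙ ≠ x for all n and (xₙ) G-converging to x. Then G is symmetric: G(x,y,y) = G(x,x,y) for all x,y ∈ X. -/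
open Filter Topology

/-- `(xₙ)` G-converges to `x`: `G(x_m, x_n, x) → 0` as `m, n → ∞`. -/
def GConvTo {X : Type*} (G : X → X → X → ℝ) (x : ℕ → X) (l : X) : Prop :=
  ∀ ε : ℝ, 0 < ε → ∃ N : ℕ, ∀ m n : ℕ, N ≤ m → N ≤ n → G (x m) (x n) l ≤ ε

/-- At a non-isolated point `y`, one of the two symmetry inequalities holds. -/
theorem IsMSMetric.le_of_gConvTo {X : Type*} {G : X → X → X → ℝ} (hG : IsMSMetric G)
    {s : ℕ → X} {y : X} (hne : ∀ n, s n ≠ y) (hs : GConvTo G s y) (x : X) :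
    G x x y ≤ G x y y := by
  refine le_of_forall_pos_le_add fun ε hε => ?_
  obtain ⟨N, hN⟩ := hs (ε / 2) (half_pos hε)
  have hsmall := hN N N le_rfl le_rfl
  have hms := hG.ms x y (s N) (hne N).symm
  have hperm : G x y (s N) = G (s N) x y := by
    rw [hG.swap_right, hG.swap_left]
  have htri := hG.tri (s N) x y y
  have hdouble := hG.tri y (s N) y (s N)
  have hyss : G y (s N) (s N) = G (s N) (s N) y := by
    rw [hG.swap_left, hG.swap_right]
  linarith [hG.swap_left y (s N) y, hG.swap_left y x y]

theorem ms_perfect_implies_symmetric {X : Type*} [Nonempty X] (G : X → X → X → ℝ)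
    (hG : IsMSMetric G)
    (hperfect : ∀ x : X, ∃ s : ℕ → X, (∀ n, s n ≠ x) ∧ GConvTo G s x) :
    ∀ x y : X, G x y y = G x x y := by
  have hle (x y : X) : G x x y ≤ G x y y := by
    obtain ⟨s, hne, hs⟩ := hperfect y
    exact hG.le_of_gConvTo hne hs x
  intro x y
  refine le_antisymm ?_ (hle x y)
  calc G x y y = G y y x := by rw [hG.swap_left, hG.swap_right]
    _ ≤ G y x x := hle y x
    _ = G x x y := by rw [hG.swap_left, hG.swap_right]
end

section
/- Let G be a Mustafa–Sims metric on a nonempty set X, let d(x,y) := max{G(x,y,y), G(x,x,y)} be the associated metric, and assume (X,d) is a complete metric space. Let T : X → X be (G,M;γ)-contractive for some γ ∈ [0,1/2), i.e. G(Tx,Ty,Tz) ≤ γ·M(x,y,z) for all x,y,z ∈ X, where M(x,y,z) := max{ G(x,Tx,y), G(y,T²x,Ty), G(Tx,T²x,Ty), G(y,Tx,Ty), G(x,Tx,z), G(z,T²x,Tz), G(Tx,T²x,Tz), G(z,Tx,Ty), G(x,y,z), G(x,Tx,Tx), G(y,Ty,Ty), G(z,Tz,Tz), G(z,Tx,Tx),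 G(x,Ty,Ty), G(y,Tz,Tz) }. Then T is a globally strong Picard operator (modulo d): Fix(T) = {x ∈ X : Tx = x} is a singleton {z}, and for every x ∈ X the iterate sequence (Tⁿx)ₙ≥₀ d-converges to z; equivalently, (Tⁿx) G-converges to z, i.e. G(T^m x, T^n x, z) → 0 as m,n → ∞. -/
open Filter Topology

/-- The quantity `M(x,y,z)` of Karapinar and Agarwal. -/
noncomputable def Mmax {X : Type*} (G : X → X → X → ℝ) (T : X → X)
    (x y z : X) : ℝ :=
  max (G x (T x) y) (max (G y (T (T x)) (T y)) (max (G (T x) (T (T x)) (T y))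
    (max (G y (T x) (T y)) (max (G x (T x) z) (max (G z (T (T x)) (T z))
      (max (G (T x) (T (T x)) (T z)) (max (G z (T x) (T y)) (max (G x y z)
        (max (G x (T x) (T x)) (max (G y (T y) (T y)) (max (G z (T z) (T z))
          (max (G z (T x) (T x)) (max (G x (T y) (T y)) (G y (T z) (T z)))))))))))))))

namespace IsMSMetric

variable {X : Type*} {G : X → X → X → ℝ}

theorem rotate (hG : IsMSMetric G) (x y z : X) : G x y z = G y z x := by
  rw [hG.swap_left, hG.swap_right]

theorem le_two_mul (hG : IsMSMetric G) (x y : X) : G x y y ≤ 2 * G x x y := by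
  have h := hG.tri y x y x
  rw [hG.swap_left y x y, hG.rotate y x x] at h
  linarith

theorem le_two_mul' (hG : IsMSMetric G) (x y : X) : G x x y ≤ 2 * G x y y := by
  have h := hG.le_two_mul y x
  rw [hG.rotate y x x, hG.rotate y y x, hG.swap_left y x y] at h
  exact h

/-- Moving all three arguments of an MS-metric. -/
theorem le_add_add_add (hG : IsMSMetric G) (a b c u v w : X) :
    G a b c ≤ G a u u + G b v v + G c w w + G u v w := by
  have h₁ := hG.tri a b c u
  have h₂ := hG.tri b c u v
  have h₃ := hG.tri c u v w
  rw [← hG.rotate u b c] at h₂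
  rw [← hG.rotate v c u] at h₃
  rw [hG.rotate w u v] at h₃
  linarith

/-- The metric `max {G(x,y,y), G(x,x,y)}` associated with an MS-metric. -/
@[reducible]
noncomputable def toPseudoMetricSpace (hG : IsMSMetric G) : PseudoMetricSpace X where
  dist x y := max (G x y y) (G x x y)
  dist_self x := by simp [hG.refl]
  dist_comm x y := by
    rw [max_comm, hG.rotate x x y, hG.rotate x y x, hG.rotate x y y, hG.swap_left y y x,
      hG.swap_right y y x]
  dist_triangle x y z := by
    have h₁ := hG.tri x z z y
    have h₂ := hG.tri z x x y
    rw [hG.rotate z x x, hG.rotate z y y, hG.rotate y x x] at h₂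
    refine max_le ?_ ?_
    · linarith [le_max_left (G x y y) (G x x y), le_max_left (G y z z) (G y y z)]
    · linarith [le_max_right (G x y y) (G x x y), le_max_right (G y z z) (G y y z)]

variable {T : X → X} {γ : ℝ}

/-- Along an orbit of a `(G,M;γ)`-contraction the consecutive distances decay geometrically. -/
theorem orbit_step_le (hG : IsMSMetric G) (hγ0 : 0 ≤ γ) (hγ1 : γ < 1 / 2)
    (hcontr : ∀ x y z : X, G (T x) (T y) (T z) ≤ γ * Mmax G T x y z) (a : X) :
    G (T a) (T (T a)) (T (T a)) ≤ γ / (1 - γ) * G a (T a) (T a) := by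
  have hc := hcontr a (T a) (T a)
  have hs := hG.nonneg a (T a) (T a)
  have ht := hG.nonneg (T a) (T (T a)) (T (T a))
  have h₂ := hG.le_two_mul' (T a) (T (T a))
  have h₃ := hG.tri a (T (T a)) (T (T a)) (T a)
  have h₀ := hG.refl (T a)
  have hM : Mmax G T a (T a) (T a) ≤
      max (2 * G (T a) (T (T a)) (T (T a)))
        (G a (T a) (T a) + G (T a) (T (T a)) (T (T a))) := by
    simp only [Mmax, max_le_iff]
    refine ⟨?_, ?_, ?_, ?_, ?_, ?_, ?_, ?_, ?_, ?_, ?_, ?_, ?_, ?_, ?_⟩ <;>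
      first
        | exact le_max_of_le_left (by linarith)
        | exact le_max_of_le_right (by linarith)
  have hγ : 0 < 1 - γ := by linarith
  rw [div_mul_eq_mul_div, le_div_iff₀ hγ]
  have hc' := hc.trans (mul_le_mul_of_nonneg_left hM hγ0)
  rcases max_cases (2 * G (T a) (T (T a)) (T (T a)))
    (G a (T a) (T a) + G (T a) (T (T a)) (T (T a))) with h | h
  · rw [h.1] at hc'
    nlinarith [mul_nonneg hγ0 hs, mul_nonneg hγ0 ht]
  · rw [h.1] at hc'
    linarith

/-- If `G(u,u,v)` satisfies the inequality obtained from the contraction condition up to an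
arbitrarily small error, then `u = v`. -/
theorem eq_of_forall_le (hG : IsMSMetric G) (hγ1 : γ < 1 / 2) {u v : X} (C : ℝ)
    (h : ∀ ε > 0, G u u v ≤ γ * (2 * G u u v) + C * ε) : u = v := by
  refine hG.eq_of_zero u v (le_antisymm ?_ (hG.nonneg u u v))
  have hle : G u u v ≤ γ * (2 * G u u v) := by
    have ht : Tendsto (fun ε : ℝ => γ * (2 * G u u v) + C * ε) (𝓝[>] 0)
        (𝓝 (γ * (2 * G u u v) + C * 0)) :=
      (Continuous.tendsto (by fun_prop) 0).mono_left nhdsWithin_le_nhds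
    rw [mul_zero, add_zero] at ht
    exact ge_of_tendsto ht (eventually_mem_nhdsWithin.mono fun ε hε => h ε hε)
  nlinarith [hG.nonneg u u v]

/-- Two fixed points of a `(G,M;γ)`-contraction coincide. -/
theorem fixedPoint_unique (hG : IsMSMetric G) (hγ0 : 0 ≤ γ) (hγ1 : γ < 1 / 2)
    (hcontr : ∀ x y z : X, G (T x) (T y) (T z) ≤ γ * Mmax G T x y z) {u w : X}
    (hu : T u = u) (hw : T w = w) : u = w := by
  refine hG.eq_of_forall_le hγ1 0 fun ε _ => ?_
  have hc := hcontr u u w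
  have hM : Mmax G T u u w ≤ 2 * G u u w := by
    have h₁ := hG.le_two_mul u w
    have h₂ := hG.nonneg u u w
    have h₃ := hG.refl u
    have h₄ := hG.refl w
    have h₅ := hG.rotate w u u
    have h₆ := hG.swap_left w u w
    simp only [Mmax, hu, hw, max_le_iff]
    refine ⟨?_, ?_, ?_, ?_, ?_, ?_, ?_, ?_, ?_, ?_, ?_, ?_, ?_, ?_, ?_⟩ <;> linarith
  rw [hu, hw] at hc
  linarith [mul_le_mul_of_nonneg_left hM hγ0]

/-- The limit of an orbit of a `(G,M;γ)`-contraction is a fixed point. -/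
theorem fixedPoint_of_orbit_close (hG : IsMSMetric G) (hγ0 : 0 ≤ γ) (hγ1 : γ < 1 / 2)
    (hcontr : ∀ x y z : X, G (T x) (T y) (T z) ≤ γ * Mmax G T x y z) {u : X}
    (hclose : ∀ ε > 0, ∃ a : X, max (G a u u) (G a a u) ≤ ε ∧
      max (G (T a) u u) (G (T a) (T a) u) ≤ ε ∧
      max (G (T (T a)) u u) (G (T (T a)) (T (T a)) u) ≤ ε) : T u = u := by
  refine (hG.eq_of_forall_le hγ1 (2 + γ * 3) fun ε hε => ?_).symm
  obtain ⟨a, ha, hb, hc⟩ := hclose ε hε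
  rw [max_le_iff] at ha hb hc
  have hcon := hcontr a a u
  have h₀ := hG.refl u
  have h₀' := hG.refl (T u)
  have hp := hG.nonneg u u (T u)
  have hq := hG.le_two_mul u (T u)
  have hleft : G u u (T u) ≤ 2 * ε + G (T a) (T a) (T u) := by
    have h := hG.le_add_add_add u u (T u) (T a) (T a) (T u)
    rw [hG.rotate u (T a) (T a)] at h
    linarith
  have hM : Mmax G T a a u ≤ 2 * G u u (T u) + 3 * ε := by
    simp only [Mmax, max_le_iff]
    refine ⟨?_, ?_, ?_, ?_, ?_, ?_, ?_, ?_, ?_, ?_, ?_, ?_, ?_, ?_, ?_⟩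
    · linarith [hG.le_add_add_add a (T a) a u u u]
    · linarith [hG.le_add_add_add a (T (T a)) (T a) u u u]
    · linarith [hG.le_add_add_add (T a) (T (T a)) (T a) u u u]
    · linarith [hG.le_add_add_add a (T a) (T a) u u u]
    · linarith [hG.le_add_add_add a (T a) u u u u]
    · linarith [hG.le_add_add_add u (T (T a)) (T u) u u (T u)]
    · linarith [hG.le_add_add_add (T a) (T (T a)) (T u) u u (T u)]
    · linarith [hG.le_add_add_add u (T a) (T a) u u u]
    · linarith [hG.le_add_add_add a a u u u u]
    · linarith [hG.le_add_add_add a (T a) (T a) u u u]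
    · linarith [hG.le_add_add_add a (T a) (T a) u u u]
    · linarith
    · linarith [hG.le_add_add_add u (T a) (T a) u u u]
    · linarith [hG.le_add_add_add a (T a) (T a) u u u]
    · linarith [hG.le_add_add_add a (T u) (T u) u (T u) (T u)]
  linarith [mul_le_mul_of_nonneg_left hM hγ0]

end IsMSMetric

theorem karapinar_agarwal {X : Type*} [Nonempty X] (G : X → X → X → ℝ)
    (hG : IsMSMetric G) (d : X → X → ℝ)
    (hd : ∀ x y, d x y = max (G x y y) (G x x y))
    (hcomplete : ∀ x : ℕ → X,
      (∀ ε : ℝ, 0 < ε → ∃ N : ℕ, ∀ m n : ℕ, N ≤ m → N ≤ n → d (x m) (x n) ≤ ε) →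
      ∃ l : X, Tendsto (fun n => d (x n) l) atTop (𝓝 0))
    (T : X → X) (γ : ℝ) (hγ0 : 0 ≤ γ) (hγ1 : γ < 1 / 2)
    (hcontr : ∀ x y z : X, G (T x) (T y) (T z) ≤ γ * Mmax G T x y z) :
    ∃ z : X, T z = z ∧ (∀ w : X, T w = w → w = z) ∧
      (∀ x : X, Tendsto (fun n => d (T^[n] x) z) atTop (𝓝 0)) ∧
      (∀ x : X, GConvTo G (fun n => T^[n] x) z) := by
  have hlim : ∀ x : X, ∃ l : X, Tendsto (fun n => d (T^[n] x) l) atTop (𝓝 0) := by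
    intro x
    let := hG.toPseudoMetricSpace
    have hdist : ∀ a b, d a b = dist a b := hd
    have hk0 : 0 ≤ γ / (1 - γ) := div_nonneg hγ0 (by linarith)
    have hk1 : γ / (1 - γ) < 1 := by
      rw [div_lt_one (by linarith)]
      linarith
    have hgeom : ∀ n, G (T^[n] x) (T^[n + 1] x) (T^[n + 1] x) ≤
        G x (T x) (T x) * (γ / (1 - γ)) ^ n := by
      intro n
      induction n with
      | zero => simp
      | succ n ih =>
        have h := hG.orbit_step_le hγ0 hγ1 hcontr (T^[n] x)
        simp only [Function.iterate_succ_apply'] at ih ⊢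
        calc _ ≤ _ := h
          _ ≤ _ := mul_le_mul_of_nonneg_left ih hk0
          _ = _ := by ring
    have hcauchy : CauchySeq fun n => T^[n] x := by
      refine cauchySeq_of_le_geometric _ (2 * G x (T x) (T x)) hk1 fun n => ?_
      rw [← hdist, hd]
      have h₁ := hG.le_two_mul' (T^[n] x) (T^[n + 1] x)
      have h₂ := hG.nonneg (T^[n] x) (T^[n + 1] x) (T^[n + 1] x)
      have h₃ := hgeom n
      exact max_le (by linarith) (by linarith)
    refine hcomplete _ fun ε hε => ?_
    obtain ⟨N, hN⟩ := Metric.cauchySeq_iff.1 hcauchy ε hε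
    exact ⟨N, fun m n hm hn => (hdist _ _).trans_le (hN m hm n hn).le⟩
  have hfix : ∀ x l : X, Tendsto (fun n => d (T^[n] x) l) atTop (𝓝 0) → T l = l := by
    intro x l hl
    refine hG.fixedPoint_of_orbit_close hγ0 hγ1 hcontr fun ε hε => ?_
    obtain ⟨N, hN⟩ := eventually_atTop.1 (hl.eventually_le_const hε)
    refine ⟨T^[N] x, ?_, ?_, ?_⟩
    · rw [← hd]
      exact hN N le_rfl
    · rw [← hd, ← Function.iterate_succ_apply' T]
      exact hN (N + 1) (by omega)
    · rw [← hd, ← Function.iterate_succ_apply' T, ← Function.iterate_succ_apply' T]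
      exact hN (N + 2) (by omega)
  obtain ⟨x₀⟩ := ‹Nonempty X›
  obtain ⟨z, hz⟩ := hlim x₀
  have hTz := hfix x₀ z hz
  have huniq : ∀ w : X, T w = w → w = z := fun w hw =>
    hG.fixedPoint_unique hγ0 hγ1 hcontr hw hTz
  have hconv : ∀ x : X, Tendsto (fun n => d (T^[n] x) z) atTop (𝓝 0) := by
    intro x
    obtain ⟨l, hl⟩ := hlim x
    rwa [← huniq l (hfix x l hl)]
  refine ⟨z, hTz, huniq, hconv, fun x ε hε => ?_⟩
  obtain ⟨N, hN⟩ := eventually_atTop.1 ((hconv x).eventually_le_const (half_pos hε))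
  refine ⟨N, fun m n hm hn => ?_⟩
  have h₁ := hN m hm
  have h₂ := hN n hn
  rw [hd, max_le_iff] at h₁ h₂
  linarith [hG.le_add_add_add (T^[m] x) (T^[n] x) z z z z, hG.refl z]
end
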